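/- For the multi-access combinatorial coded caching system with C caches, access degree 1 ≤ r < C−1, K = C(C,r) users, and N ≥ 2 files, if K ≤ 5(r+1), then for every memory size M ≥ N/(C−r) + C(C−1,r−1) the proposed secretive-and-private scheme is within a multiplicative factor 5 of optimal: there is an achievable pair (M, R) with R ≤ C(C,r)/(r+1), and C(C,r)/(r+1) ≤ 5·R*(M), so R(M)/R*(M) ≤ 5. -/

import Mathlib

open Finset

/-- Probability that the finitely-valued random variable `X` takes the value `a`,
on the finite probability space with mass function `μ`. -/
noncomputable def probOf {Ω α : Type} [Fintype Ω] [DecidableEq α]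
    (μ : Ω → ℝ) (X : Ω → α) (a : α) : ℝ :=
  ∑ ω ∈ Finset.univ.filter (fun ω => X ω = a), μ ω

/-- Shannon entropy (in bits) of a finitely-valued random variable. -/
noncomputable def shannonH {Ω α : Type} [Fintype Ω] [Fintype α] [DecidableEq α]
    (μ : Ω → ℝ) (X : Ω → α) : ℝ :=
  (∑ a : α, Real.negMulLog (probOf μ X a)) / Real.log 2

/-- Conditional Shannon entropy `H(X | Y)` (in bits). -/
noncomputable def condH {Ω α β : Type} [Fintype Ω] [Fintype α] [Fintype β]
    [DecidableEq α] [DecidableEq β] (μ : Ω → ℝ) (X : Ω → α) (Y : Ω → β) : ℝ :=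
  shannonH μ (fun ω => (X ω, Y ω)) - shannonH μ Y

/-- Mutual information `I(X ; Y)` (in bits). -/
noncomputable def mutInf {Ω α β : Type} [Fintype Ω] [Fintype α] [Fintype β]
    [DecidableEq α] [DecidableEq β] (μ : Ω → ℝ) (X : Ω → α) (Y : Ω → β) : ℝ :=
  shannonH μ X + shannonH μ Y - shannonH μ (fun ω => (X ω, Y ω))
/-- The users of the multi-access combinatorial topology with `C` caches and access
degree `r`: each user is indexed by an `r`-subset of `[C]`. -/
abbrev UserT (C r : ℕ) := {G : Finset (Fin C) // G.card = r}

/-- A secretive and demand-private coded caching scheme for the multi-access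
combinatorial topology with `C` caches, access degree `r`, `N` files of `F` bits
each, cache size `M` files and rate `R`.  The server randomness `P`, the files `W`
(i.i.d. uniform bits) and the demands `D` (uniform on `[N]^K`) are mutually
independent; the cache contents `ψ c (P, W)` take at most `2^(M·F)` values and the
transmission `φ (P, D, W)` takes at most `2^(R·F)` values; the scheme satisfies the
correctness, secrecy and demand-privacy conditions. -/
structure CCScheme (C r N F : ℕ) (M R : ℝ) where
  Ω : Type
  [fintΩ : Fintype Ω]
  PT : Type
  [fintP : Fintype PT]
  [deqP : DecidableEq PT]
  ZT : Type
  [fintZ : Fintype ZT]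
  [deqZ : DecidableEq ZT]
  XT : Type
  [fintX : Fintype XT]
  [deqX : DecidableEq XT]
  μ : Ω → ℝ
  P : Ω → PT
  W : Ω → Fin N → Fin F → Bool
  D : Ω → UserT C r → Fin N
  ψ : Fin C → PT → (Fin N → Fin F → Bool) → ZT
  φ : PT → (UserT C r → Fin N) → (Fin N → Fin F → Bool) → XT
  μ_nonneg : ∀ ω, 0 ≤ μ ω
  μ_sum_one : ∑ ω, μ ω = 1
  /-- each cache holds `M` files, i.e. `M·F` bits -/
  card_ZT : (Fintype.card ZT : ℝ) ≤ (2 : ℝ) ^ (M * (F : ℝ))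
  /-- the transmission consists of `R·F` bits -/
  card_XT : (Fintype.card XT : ℝ) ≤ (2 : ℝ) ^ (R * (F : ℝ))
  /-- the randomness `P`, the files `W` (i.i.d. uniform `F`-bit strings) and the
  demands `D` (uniform on `[N]^K`) are mutually independent -/
  indep : ∀ (p : PT) (w : Fin N → Fin F → Bool) (d : UserT C r → Fin N),
    probOf μ (fun ω => (P ω, W ω, D ω)) (p, w, d)
      = probOf μ P p * ((1 : ℝ) / (2 : ℝ) ^ (N * F))
          * ((1 : ℝ) / (N : ℝ) ^ (Fintype.card (UserT C r)))
  /-- correctness : `H(W_{d_G} | X, d_G, Z_G) = 0` -/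
  correctness : ∀ G : UserT C r,
    condH μ (fun ω => W ω (D ω G))
      (fun ω => (φ (P ω) (D ω) (W ω), D ω G,
        (fun c : {c : Fin C // c ∈ G.1} => ψ c.1 (P ω) (W ω)))) = 0
  /-- secrecy : `I(W_{[N]∖{d_G}} ; X, Z_G) = 0` -/
  secrecy : ∀ G : UserT C r,
    mutInf μ
      (fun ω => fun i : Fin N =>
        if i = D ω G then (none : Option (Fin F → Bool)) else some (W ω i))
      (fun ω => (φ (P ω) (D ω) (W ω),
        (fun c : {c : Fin C // c ∈ G.1} => ψ c.1 (P ω) (W ω)))) = 0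
  /-- demand privacy : `I(d_{−G} ; X, d_G, Z_G) = 0` -/
  privacy : ∀ G : UserT C r,
    mutInf μ
      (fun ω => fun G' : UserT C r =>
        if G' = G then (none : Option (Fin N)) else some (D ω G'))
      (fun ω => (φ (P ω) (D ω) (W ω), D ω G,
        (fun c : {c : Fin C // c ∈ G.1} => ψ c.1 (P ω) (W ω)))) = 0

theorem probOf_nonneg {Ω α : Type} [Fintype Ω] [DecidableEq α] {μ : Ω → ℝ}
    (hμ : ∀ ω, 0 ≤ μ ω) (X : Ω → α) (a : α) : 0 ≤ probOf μ X a :=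
  Finset.sum_nonneg fun ω _ => hμ ω

theorem probOf_pos_iff {Ω α : Type} [Fintype Ω] [DecidableEq α] {μ : Ω → ℝ}
    (hμ : ∀ ω, 0 ≤ μ ω) {X : Ω → α} {a : α} :
    0 < probOf μ X a ↔ ∃ ω, X ω = a ∧ 0 < μ ω := by
  unfold probOf
  rw [Finset.sum_pos_iff_of_nonneg fun ω _ => hμ ω]
  simp

theorem sum_probOf {Ω α : Type} [Fintype Ω] [Fintype α] [DecidableEq α] (μ : Ω → ℝ)
    (X : Ω → α) : ∑ a, probOf μ X a = ∑ ω, μ ω := by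
  unfold probOf
  exact Finset.sum_fiberwise _ _ _

theorem sum_probOf_prod_left {Ω α β : Type} [Fintype Ω] [Fintype α] [DecidableEq α]
    [DecidableEq β] (μ : Ω → ℝ) (X : Ω → α) (Y : Ω → β) (b : β) :
    ∑ a, probOf μ (fun ω => (X ω, Y ω)) (a, b) = probOf μ Y b := by
  unfold probOf
  rw [← Finset.sum_fiberwise (Finset.univ.filter fun ω => Y ω = b) X]
  refine Finset.sum_congr rfl fun a _ => ?_
  rw [Finset.filter_filter]
  refine Finset.sum_congr (Finset.filter_congr fun ω _ => ?_) fun _ _ => rfl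
  simp [and_comm]

theorem sum_probOf_prod_right {Ω α β : Type} [Fintype Ω] [Fintype β] [DecidableEq α]
    [DecidableEq β] (μ : Ω → ℝ) (X : Ω → α) (Y : Ω → β) (a : α) :
    ∑ b, probOf μ (fun ω => (X ω, Y ω)) (a, b) = probOf μ X a := by
  unfold probOf
  rw [← Finset.sum_fiberwise (Finset.univ.filter fun ω => X ω = a) Y]
  refine Finset.sum_congr rfl fun b _ => ?_
  rw [Finset.filter_filter]
  refine Finset.sum_congr (Finset.filter_congr fun ω _ => ?_) fun _ _ => rfl
  simp

theorem condH_eq_zero_of_determined {Ω α β : Type} [Fintype Ω] [Fintype α] [Fintype β]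
    [DecidableEq α] [DecidableEq β] (μ : Ω → ℝ) (X : Ω → α) (Y : Ω → β)
    (h : ∀ ω ω', Y ω = Y ω' → X ω = X ω') : condH μ X Y = 0 := by
  have key : ∀ b, ∑ a, Real.negMulLog (probOf μ (fun ω => (X ω, Y ω)) (a, b))
      = Real.negMulLog (probOf μ Y b) := by
    intro b
    by_cases hb : ∃ ω, Y ω = b
    · obtain ⟨ω₀, rfl⟩ := hb
      rw [Finset.sum_eq_single (X ω₀)]
      · congr 1
        unfold probOf
        refine Finset.sum_congr (Finset.filter_congr fun ω _ => ?_) fun _ _ => rfl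
        simp only [Prod.mk.injEq, and_iff_right_iff_imp]
        exact h ω ω₀
      · intro a _ ha
        have : probOf μ (fun ω => (X ω, Y ω)) (a, Y ω₀) = 0 := by
          unfold probOf
          rw [Finset.filter_false_of_mem, Finset.sum_empty]
          intro ω _ hω
          simp only [Prod.mk.injEq] at hω
          exact ha (hω.1.symm.trans (h ω ω₀ hω.2))
        rw [this, Real.negMulLog_zero]
      · simp
    · have h0 : probOf μ Y b = 0 := by
        unfold probOf
        rw [Finset.filter_false_of_mem, Finset.sum_empty]
        exact fun ω _ hω => hb ⟨ω, hω⟩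
      have h1 : ∀ a, probOf μ (fun ω => (X ω, Y ω)) (a, b) = 0 := by
        intro a
        unfold probOf
        rw [Finset.filter_false_of_mem, Finset.sum_empty]
        exact fun ω _ hω => hb ⟨ω, (Prod.ext_iff.1 hω).2⟩
      simp [h0, h1]
  unfold condH shannonH
  rw [Fintype.sum_prod_type_right]
  simp_rw [key, sub_self]

theorem mutInf_eq_zero_of_indep {Ω α β : Type} [Fintype Ω] [Fintype α] [Fintype β]
    [DecidableEq α] [DecidableEq β] {μ : Ω → ℝ} (hμ : ∑ ω, μ ω = 1) (X : Ω → α) (Y : Ω → β)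
    (h : ∀ a b, probOf μ (fun ω => (X ω, Y ω)) (a, b) = probOf μ X a * probOf μ Y b) :
    mutInf μ X Y = 0 := by
  have key : ∑ x : α × β, Real.negMulLog (probOf μ (fun ω => (X ω, Y ω)) x)
      = ∑ a, Real.negMulLog (probOf μ X a) + ∑ b, Real.negMulLog (probOf μ Y b) := by
    rw [Fintype.sum_prod_type]
    simp_rw [h, Real.negMulLog_mul, Finset.sum_add_distrib, ← Finset.mul_sum, ← Finset.sum_mul]
    simp only [sum_probOf, hμ, one_mul]
  unfold mutInf shannonH
  rw [key]
  ring

/-- If the level sets of `X` are exchanged by injections preserving `Y`, then the two are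
independent under the uniform law. -/
theorem mutInf_eq_zero_of_exchange {Ω α β : Type} [Fintype Ω] [Nonempty Ω] [Fintype α]
    [Fintype β] [DecidableEq α] [DecidableEq β] (X : Ω → α) (Y : Ω → β)
    (h : ∀ ω₀ ω₁, ∃ f : Ω → Ω, Set.InjOn f {ω | X ω = X ω₀} ∧
      ∀ ω, X ω = X ω₀ → X (f ω) = X ω₁ ∧ Y (f ω) = Y ω) :
    mutInf (fun _ : Ω => ((Fintype.card Ω : ℝ))⁻¹) X Y = 0 := by
  classical
  set μ : Ω → ℝ := fun _ => ((Fintype.card Ω : ℝ))⁻¹ with hμ_def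
  have hμ : ∑ ω, μ ω = 1 := by simp [hμ_def]
  have hle : ∀ ω₀ ω₁ b, probOf μ (fun ω => (X ω, Y ω)) (X ω₀, b)
      ≤ probOf μ (fun ω => (X ω, Y ω)) (X ω₁, b) := by
    intro ω₀ ω₁ b
    obtain ⟨f, hf, hfX⟩ := h ω₀ ω₁
    unfold probOf
    simp only [hμ_def, Finset.sum_const, nsmul_eq_mul]
    refine mul_le_mul_of_nonneg_right ?_ (by positivity)
    norm_cast
    refine Finset.card_le_card_of_injOn f ?_ ?_
    · intro ω hω
      simp only [Finset.coe_filter, Finset.mem_univ, true_and, Set.mem_ofPred_eq,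
        Prod.mk.injEq] at hω ⊢
      exact ⟨(hfX ω hω.1).1, (hfX ω hω.1).2.trans hω.2⟩
    · refine hf.mono fun ω hω => ?_
      simp only [Finset.coe_filter, Finset.mem_univ, true_and, Set.mem_ofPred_eq,
        Prod.mk.injEq] at hω ⊢
      exact hω.1
  obtain ⟨ω₀⟩ := ‹Nonempty Ω›
  set g : β → ℝ := fun b => probOf μ (fun ω => (X ω, Y ω)) (X ω₀, b) with hg
  have hjoint : ∀ a b, probOf μ (fun ω => (X ω, Y ω)) (a, b)
      = (if ∃ ω, X ω = a then 1 else 0) * g b := by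
    intro a b
    split_ifs with ha
    · obtain ⟨ω₁, rfl⟩ := ha
      rw [one_mul]
      exact le_antisymm (hle _ _ _) (hle _ _ _)
    · unfold probOf
      rw [Finset.filter_false_of_mem, Finset.sum_empty, zero_mul]
      exact fun ω _ hω => ha ⟨ω, (Prod.ext_iff.1 hω).1⟩
  set c : ℝ := ∑ a : α, if ∃ ω, X ω = a then 1 else 0
  have hX : ∀ a, probOf μ X a = (if ∃ ω, X ω = a then 1 else 0) * ∑ b, g b := by
    intro a
    rw [← sum_probOf_prod_right μ X Y a, Finset.mul_sum]
    exact Finset.sum_congr rfl fun b _ => hjoint a b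
  have hY : ∀ b, probOf μ Y b = c * g b := by
    intro b
    rw [← sum_probOf_prod_left μ X Y b, Finset.sum_mul]
    exact Finset.sum_congr rfl fun a _ => hjoint a b
  have hone : c * ∑ b, g b = 1 := by
    rw [Finset.mul_sum, ← hμ, ← sum_probOf μ Y]
    exact Finset.sum_congr rfl fun b _ => (hY b).symm
  refine mutInf_eq_zero_of_indep hμ X Y fun a b => ?_
  rw [hjoint, hX, hY]
  linear_combination (-(if ∃ ω, X ω = a then (1 : ℝ) else 0) * g b) * hone

theorem probOf_prod_le_left {Ω α β : Type} [Fintype Ω] [DecidableEq α] [DecidableEq β]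
    {μ : Ω → ℝ} (hμ : ∀ ω, 0 ≤ μ ω) (X : Ω → α) (Y : Ω → β) (a : α) (b : β) :
    probOf μ (fun ω => (X ω, Y ω)) (a, b) ≤ probOf μ X a := by
  refine Finset.sum_le_sum_of_subset_of_nonneg ?_ fun ω _ _ => hμ ω
  intro ω hω
  simp only [Finset.mem_filter, Finset.mem_univ, true_and, Prod.mk.injEq] at hω ⊢
  exact hω.1

theorem probOf_prod_le_right {Ω α β : Type} [Fintype Ω] [DecidableEq α] [DecidableEq β]
    {μ : Ω → ℝ} (hμ : ∀ ω, 0 ≤ μ ω) (X : Ω → α) (Y : Ω → β) (a : α) (b : β) :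
    probOf μ (fun ω => (X ω, Y ω)) (a, b) ≤ probOf μ Y b := by
  refine Finset.sum_le_sum_of_subset_of_nonneg ?_ fun ω _ _ => hμ ω
  intro ω hω
  simp only [Finset.mem_filter, Finset.mem_univ, true_and, Prod.mk.injEq] at hω ⊢
  exact hω.2

theorem mul_log_sub_ge {x y z : ℝ} (hx : 0 ≤ x) (hxy : x ≤ y) (hxz : x ≤ z) :
    x - y * z ≤ x * (Real.log x - Real.log y - Real.log z) := by
  rcases hx.eq_or_lt with rfl | hx
  · simpa using mul_nonneg hxy hxz
  have hy := hx.trans_le hxy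
  have hz := hx.trans_le hxz
  have h := Real.log_le_sub_one_of_pos (show 0 < y * z / x by positivity)
  rw [Real.log_div (by positivity) hx.ne', Real.log_mul hy.ne' hz.ne'] at h
  have h2 := mul_le_mul_of_nonneg_left h hx.le
  have h3 : x * (y * z / x - 1) = y * z - x := by field_simp
  linarith

theorem eq_mul_of_mul_log_sub_eq {x y z : ℝ} (hx : 0 ≤ x) (hxy : x ≤ y) (hxz : x ≤ z)
    (h : x * (Real.log x - Real.log y - Real.log z) = x - y * z) : x = y * z := by
  rcases hx.eq_or_lt with rfl | hx
  · linarith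
  have hy := hx.trans_le hxy
  have hz := hx.trans_le hxz
  by_contra hne
  have h1 := Real.log_lt_sub_one_of_pos (show 0 < y * z / x by positivity)
    (by rw [Ne, div_eq_one_iff_eq hx.ne']; exact fun e => hne e.symm)
  rw [Real.log_div (by positivity) hx.ne', Real.log_mul hy.ne' hz.ne'] at h1
  have h2 := mul_lt_mul_of_pos_left h1 hx
  have h3 : x * (y * z / x - 1) = y * z - x := by field_simp
  linarith

theorem indep_of_mutInf_eq_zero {Ω α β : Type} [Fintype Ω] [Fintype α] [Fintype β]
    [DecidableEq α] [DecidableEq β] {μ : Ω → ℝ} (hμ : ∀ ω, 0 ≤ μ ω) (hμ1 : ∑ ω, μ ω = 1)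
    {X : Ω → α} {Y : Ω → β} (h : mutInf μ X Y = 0) (a : α) (b : β) :
    probOf μ (fun ω => (X ω, Y ω)) (a, b) = probOf μ X a * probOf μ Y b := by
  set p : α × β → ℝ := probOf μ (fun ω => (X ω, Y ω)) with hp
  have hlog : Real.log 2 ≠ 0 := (Real.log_pos one_lt_two).ne'
  have hX : ∑ a, Real.negMulLog (probOf μ X a)
      = ∑ x : α × β, -(p x * Real.log (probOf μ X x.1)) := by
    rw [Fintype.sum_prod_type]
    refine Finset.sum_congr rfl fun a _ => ?_
    dsimp only
    rw [Finset.sum_neg_distrib, ← Finset.sum_mul, sum_probOf_prod_right, Real.negMulLog, neg_mul]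
  have hY : ∑ b, Real.negMulLog (probOf μ Y b)
      = ∑ x : α × β, -(p x * Real.log (probOf μ Y x.2)) := by
    rw [Fintype.sum_prod_type_right]
    refine Finset.sum_congr rfl fun b _ => ?_
    dsimp only
    rw [Finset.sum_neg_distrib, ← Finset.sum_mul, sum_probOf_prod_left, Real.negMulLog, neg_mul]
  have hsum : ∑ x : α × β, p x * (Real.log (p x) - Real.log (probOf μ X x.1)
      - Real.log (probOf μ Y x.2)) = 0 := by
    unfold mutInf shannonH at h
    rw [← add_div, ← sub_div, div_eq_zero_iff, or_iff_left hlog, hX, hY,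
      ← Finset.sum_add_distrib, ← Finset.sum_sub_distrib] at h
    rw [← h]
    refine Finset.sum_congr rfl fun x _ => ?_
    rw [Real.negMulLog]
    ring
  have hsum2 : ∑ x : α × β, (p x - probOf μ X x.1 * probOf μ Y x.2) = 0 := by
    rw [Finset.sum_sub_distrib, hp, sum_probOf, Fintype.sum_prod_type]
    simp_rw [← Finset.mul_sum, ← Finset.sum_mul, sum_probOf, hμ1]
    norm_num
  have hle : ∀ x ∈ (Finset.univ : Finset (α × β)), p x - probOf μ X x.1 * probOf μ Y x.2
      ≤ p x * (Real.log (p x) - Real.log (probOf μ X x.1) - Real.log (probOf μ Y x.2)) :=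
    fun x _ => mul_log_sub_ge (probOf_nonneg hμ _ _) (probOf_prod_le_left hμ X Y x.1 x.2)
      (probOf_prod_le_right hμ X Y x.1 x.2)
  have := (Finset.sum_eq_sum_iff_of_le hle).1 (hsum2.trans hsum.symm) (a, b) (Finset.mem_univ _)
  exact eq_mul_of_mul_log_sub_eq (probOf_nonneg hμ _ _) (probOf_prod_le_left hμ X Y a b)
    (probOf_prod_le_right hμ X Y a b) this.symm

theorem eq_of_condH_eq_zero {Ω α β : Type} [Fintype Ω] [Fintype α] [Fintype β]
    [DecidableEq α] [DecidableEq β] {μ : Ω → ℝ} (hμ : ∀ ω, 0 ≤ μ ω)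
    {X : Ω → α} {Y : Ω → β} (h : condH μ X Y = 0) {ω ω' : Ω} (hω : 0 < μ ω) (hω' : 0 < μ ω')
    (hY : Y ω = Y ω') : X ω = X ω' := by
  set p : α × β → ℝ := probOf μ (fun ω => (X ω, Y ω)) with hp
  have hlog : Real.log 2 ≠ 0 := (Real.log_pos one_lt_two).ne'
  have hYs : ∑ b, Real.negMulLog (probOf μ Y b)
      = ∑ x : α × β, -(p x * Real.log (probOf μ Y x.2)) := by
    rw [Fintype.sum_prod_type_right]
    refine Finset.sum_congr rfl fun b _ => ?_
    dsimp only
    rw [Finset.sum_neg_distrib, ← Finset.sum_mul, sum_probOf_prod_left, Real.negMulLog, neg_mul]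
  have hsum : ∑ x : α × β, p x * (Real.log (probOf μ Y x.2) - Real.log (p x)) = 0 := by
    unfold condH shannonH at h
    rw [← sub_div, div_eq_zero_iff, or_iff_left hlog, hYs, ← Finset.sum_sub_distrib] at h
    rw [← h]
    refine Finset.sum_congr rfl fun x _ => ?_
    rw [Real.negMulLog]
    ring
  have hnn : ∀ x ∈ (Finset.univ : Finset (α × β)),
      0 ≤ p x * (Real.log (probOf μ Y x.2) - Real.log (p x)) := by
    intro x _
    rcases (probOf_nonneg hμ (fun ω => (X ω, Y ω)) x).eq_or_lt with h0 | h0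
    · rw [hp, ← h0, zero_mul]
    · exact mul_nonneg h0.le (sub_nonneg.2 (Real.log_le_log h0
        (probOf_prod_le_right hμ X Y x.1 x.2)))
  have heq : ∀ ν, 0 < μ ν → p (X ν, Y ν) = probOf μ Y (Y ν) := by
    intro ν hν
    have h0 : 0 < p (X ν, Y ν) := (probOf_pos_iff hμ).2 ⟨ν, rfl, hν⟩
    have h1 := (Finset.sum_eq_zero_iff_of_nonneg hnn).1 hsum (X ν, Y ν) (Finset.mem_univ _)
    have h2 := (mul_eq_zero.1 h1).resolve_left h0.ne'
    exact (Real.log_injOn_pos (h0.trans_le (probOf_prod_le_right hμ X Y _ _)) h0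
      (sub_eq_zero.1 h2)).symm
  by_contra hne
  have h0 : 0 < p (X ω', Y ω') := (probOf_pos_iff hμ).2 ⟨ω', rfl, hω'⟩
  have h1 : p (X ω, Y ω) + p (X ω', Y ω) ≤ probOf μ Y (Y ω) := by
    rw [← sum_probOf_prod_left μ X Y (Y ω), ← Finset.sum_pair (f := fun a => p (a, Y ω)) hne]
    exact Finset.sum_le_sum_of_subset_of_nonneg (Finset.subset_univ _)
      fun a _ _ => probOf_nonneg hμ _ _
  rw [heq ω hω, hY] at h1
  linarith

/-- In any secretive scheme each user must receive at least one file. -/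
theorem CCScheme.one_le_rate {C r N F : ℕ} {M R : ℝ} (s : CCScheme C r N F M R) (hF : 1 ≤ F)
    (hN : 2 ≤ N) (hr : r ≤ C) : 1 ≤ R := by
  classical
  obtain ⟨Ω, PT, ZT, XT, μ, P, W, D, ψ, φ, μ_nonneg, μ_sum, -, card_XT, indep, correctness,
    secrecy, -⟩ := s
  obtain ⟨g, -, hg⟩ := Finset.exists_subset_card_eq
    (show r ≤ (Finset.univ : Finset (Fin C)).card by simpa using hr)
  let G : UserT C r := ⟨g, hg⟩
  have hpos : ∀ p w d, 0 < probOf μ P p → ∃ ω, P ω = p ∧ W ω = w ∧ D ω = d ∧ 0 < μ ω := by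
    intro p w d hp
    have : 0 < probOf μ (fun ω => (P ω, W ω, D ω)) (p, w, d) := by
      rw [indep]
      have : (0 : ℝ) < N := by exact_mod_cast (by omega : 0 < N)
      positivity
    obtain ⟨ω, hω, h⟩ := (probOf_pos_iff μ_nonneg).1 this
    simp only [Prod.mk.injEq] at hω
    exact ⟨ω, hω.1, hω.2.1, hω.2.2, h⟩
  have hPpos : ∀ ω, 0 < μ ω → 0 < probOf μ P (P ω) :=
    fun ω h => (probOf_pos_iff μ_nonneg).2 ⟨ω, rfl, h⟩
  obtain ⟨ω₀, hω₀⟩ : ∃ ω, 0 < μ ω := by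
    by_contra! hcon
    have : ∑ ω, μ ω ≤ 0 := Finset.sum_nonpos fun ω _ => hcon ω
    linarith
  let i₀ : Fin N := ⟨0, by omega⟩
  let i₁ : Fin N := ⟨1, by omega⟩
  have hi : i₀ ≠ i₁ := by simp [i₀, i₁]
  let Z : Ω → {c : Fin C // c ∈ G.1} → ZT := fun ω c => ψ c.1 (P ω) (W ω)
  have hex : ∀ v : Fin F → Bool, ∃ ω, 0 < μ ω ∧ W ω i₀ = v ∧ D ω G = i₀ ∧ Z ω = Z ω₀ := by
    intro v
    obtain ⟨ω₁, -, hW₁, hD₁, hω₁⟩ := hpos (P ω₀) (fun _ => v) (fun _ => i₁) (hPpos ω₀ hω₀)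
    have hind := indep_of_mutInf_eq_zero μ_nonneg μ_sum (secrecy G)
      (fun i => if i = D ω₁ G then none else some (W ω₁ i))
      (φ (P ω₀) (D ω₀) (W ω₀), Z ω₀)
    have h1 : 0 < probOf μ (fun ω => fun i : Fin N =>
        if i = D ω G then (none : Option (Fin F → Bool)) else some (W ω i))
        (fun i => if i = D ω₁ G then none else some (W ω₁ i)) :=
      (probOf_pos_iff μ_nonneg).2 ⟨ω₁, rfl, hω₁⟩
    have h2 : 0 < probOf μ (fun ω => (φ (P ω) (D ω) (W ω),
        (fun c : {c : Fin C // c ∈ G.1} => ψ c.1 (P ω) (W ω))))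
        (φ (P ω₀) (D ω₀) (W ω₀), Z ω₀) :=
      (probOf_pos_iff μ_nonneg).2 ⟨ω₀, rfl, hω₀⟩
    have h3 := mul_pos h1 h2
    rw [← hind, probOf_pos_iff μ_nonneg] at h3
    obtain ⟨ω₂, h4, hω₂⟩ := h3
    simp only [Prod.mk.injEq] at h4
    obtain ⟨hmask, -, hZ⟩ := h4
    have hW₂ : W ω₂ i₀ = v := by
      have := congrFun hmask i₀
      simp only [hD₁, hW₁, if_neg hi] at this
      split_ifs at this
      exact Option.some_injective _ this
    obtain ⟨ω₃, hP₃, hW₃, hD₃, hω₃⟩ := hpos (P ω₂) (W ω₂) (fun _ => i₀) (hPpos ω₂ hω₂)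
    refine ⟨ω₃, hω₃, by rw [hW₃, hW₂], by rw [hD₃], ?_⟩
    rw [← hZ]
    funext c
    simp only [Z, hP₃, hW₃]
  choose f hfμ hfW hfD hfZ using hex
  have hinj : Function.Injective fun v => φ (P (f v)) (D (f v)) (W (f v)) := by
    intro v v' hvv
    have := eq_of_condH_eq_zero μ_nonneg (correctness G) (hfμ v) (hfμ v') (by
      simp only [Prod.mk.injEq]
      exact ⟨hvv, by rw [hfD, hfD], (hfZ v).trans (hfZ v').symm⟩)
    simpa [hfD, hfW] using this
  have hcard := Fintype.card_le_of_injective _ hinj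
  simp only [Fintype.card_fun, Fintype.card_bool, Fintype.card_fin] at hcard
  have hreal : (2 : ℝ) ^ (F : ℝ) ≤ (2 : ℝ) ^ (R * (F : ℝ)) := by
    refine le_trans ?_ card_XT
    rw [Real.rpow_natCast]
    exact_mod_cast hcard
  rw [Real.rpow_le_rpow_left_iff one_lt_two] at hreal
  have hF0 : (0 : ℝ) < F := by exact_mod_cast hF
  nlinarith

/-- The server randomness of a delivery code: a blinding vector for each demand, noise hiding the
files inside their shares, a one-time pad on each transmission slot, and randomness for splitting
each key among caches. -/
@[ext]
structure Seed (C r N : ℕ) (𝕜 A S L : Type) where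
  blind : UserT C r → Fin N → 𝕜
  noise : Fin N → A → 𝕜
  pad : S → 𝕜
  split : UserT C r → Fin C → L → 𝕜

instance {C r N : ℕ} {𝕜 A S L : Type} [Finite 𝕜] [Finite A] [Finite S] [Finite L] :
    Finite (Seed C r N 𝕜 A S L) :=
  Finite.of_injective (fun p => (p.blind, p.noise, p.pad, p.split)) fun p p' h => by
    simp only [Prod.mk.injEq] at h
    exact Seed.ext h.1 h.2.1 h.2.2.1 h.2.2.2

/-- The combinatorial data behind a linear delivery scheme. A file is a vector in `L → 𝕜`, and
a share vector in `A → 𝕜` determines it through `rebuild`. Cache `c` stores the shares `a` with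
`stored c a`; user `G` obtains each share it is missing from the transmission slot `slot G a`. -/
structure DeliveryCode (C r : ℕ) (𝕜 A S L : Type) [Field 𝕜] where
  stored : Fin C → A → Prop
  slot : UserT C r → A → S
  rebuild : (A → 𝕜) →ₗ[𝕜] (L → 𝕜)
  fill : UserT C r → (L → 𝕜) → A → 𝕜
  lead : UserT C r → Fin C
  base : UserT C r
  lead_mem : ∀ G, lead G ∈ G.1
  rebuild_fill : ∀ G m, rebuild (fill G m) = m
  fill_stored : ∀ G m c, c ∈ G.1 → ∀ a, stored c a → fill G m a = 0
  /-- distinct missing shares sent in one slot are never missing for the same user -/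
  slot_collision : ∀ H a G b, (∀ c ∈ H.1, ¬ stored c a) → (∀ c ∈ G.1, ¬ stored c b) →
    slot G b = slot H a → (G ≠ H ∨ b ≠ a) → ∃ c ∈ H.1, stored c b

namespace DeliveryCode

open scoped Classical

noncomputable section

variable {C r N : ℕ} {𝕜 A S L : Type} [Field 𝕜]
  (K : DeliveryCode C r 𝕜 A S L) (o : Fin N)

/-- User `G` has no access to the share `a`. -/
def Missing (G : UserT C r) (a : A) : Prop := ∀ c ∈ G.1, ¬ K.stored c a

def share (ρ : Fin N → A → 𝕜) (w : Fin N → L → 𝕜) (n : Fin N) : A → 𝕜 :=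
  ρ n - K.fill K.base (K.rebuild (ρ n)) + K.fill K.base (w n)

/-- The shares of the file differences `w n - w o`; only these are cached. -/
def diff (ρ : Fin N → A → 𝕜) (w : Fin N → L → 𝕜) (n : Fin N) : A → 𝕜 :=
  K.share ρ w n - K.share ρ w o

def combo (q : Fin N → 𝕜) (z : Fin N → A → 𝕜) (a : A) : 𝕜 := ∑ n, q n * z n a

/-- The combination of all the shares requested through slot `s`. -/
def load [Fintype A] (q : UserT C r → Fin N → 𝕜) (z : Fin N → A → 𝕜) (s : S) : 𝕜 :=
  ∑ G, ∑ b, if K.Missing G b ∧ K.slot G b = s then combo (q G) z b else 0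

/-- The part of the slot carrying the share `a` to `H` which `H` computes from its caches. -/
def others [Fintype A] (q : UserT C r → Fin N → 𝕜) (z : Fin N → A → 𝕜) (H : UserT C r)
    (a : A) : 𝕜 :=
  ∑ G, ∑ b, if K.Missing G b ∧ K.slot G b = K.slot H a ∧ ¬ K.Missing H b
    then combo (q G) z b else 0

def missPart (H : UserT C r) (x : A → 𝕜) (a : A) : 𝕜 := if K.Missing H a then x a else 0

/-- The contribution of the accessible shares to the reconstruction of file `n`. -/
def accessible (H : UserT C r) (z : Fin N → A → 𝕜) (n : Fin N) : L → 𝕜 :=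
  K.rebuild (z n - K.missPart H (z n))

def query (p : Seed C r N 𝕜 A S L) (d : UserT C r → Fin N) (G : UserT C r) : Fin N → 𝕜 :=
  p.blind G + Pi.single (d G) 1

def signal [Fintype A] (p : Seed C r N 𝕜 A S L) (d : UserT C r → Fin N) (w : Fin N → L → 𝕜) :
    S → 𝕜 :=
  p.pad + K.load (query p d) (K.diff o p.noise w)

/-- The secret key of user `G`, of the size of one file. -/
def key (p : Seed C r N 𝕜 A S L) (w : Fin N → L → 𝕜) (G : UserT C r) : L → 𝕜 :=
  K.rebuild (K.missPart G fun a => p.pad (K.slot G a) + combo (p.blind G) (K.diff o p.noise w) a)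
    - w o

/-- The additive piece of the key of user `G` kept in cache `c`. -/
def piece (p : Seed C r N 𝕜 A S L) (w : Fin N → L → 𝕜) (G : UserT C r) (c : Fin C) : L → 𝕜 :=
  p.split G c + if c = K.lead G then K.key o p w G - ∑ c' ∈ G.1, p.split G c' else 0

/-- The contents of cache `c`. -/
def cache (c : Fin C) (p : Seed C r N 𝕜 A S L) (w : Fin N → L → 𝕜) :
    ({n : Fin N // n ≠ o} → {a : A // K.stored c a} → 𝕜) ×
      ({G : UserT C r // c ∈ G.1} → L → 𝕜) :=
  (fun n a => K.diff o p.noise w n a, fun G => K.piece o p w G c)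

/-- Cache differences agree for `H` on its accessible shares. -/
def Agree (H : UserT C r) (z z' : Fin N → A → 𝕜) : Prop :=
  ∀ a, ¬ K.Missing H a → ∀ n, z n a = z' n a

variable {K}

theorem rebuild_share (ρ : Fin N → A → 𝕜) (w : Fin N → L → 𝕜) (n : Fin N) :
    K.rebuild (K.share ρ w n) = w n := by
  simp [share, K.rebuild_fill]

theorem rebuild_diff (ρ : Fin N → A → 𝕜) (w : Fin N → L → 𝕜) (n : Fin N) :
    K.rebuild (K.diff o ρ w n) = w n - w o := by
  rw [diff, map_sub, rebuild_share, rebuild_share]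

theorem fill_of_not_missing {H : UserT C r} {a : A} (ha : ¬ K.Missing H a) (m : L → 𝕜) :
    K.fill H m a = 0 := by
  simp only [Missing, not_forall, not_not] at ha
  obtain ⟨c, hc, hca⟩ := ha
  exact K.fill_stored H m c hc a hca

theorem load_slot [Fintype A] (q : UserT C r → Fin N → 𝕜) (z : Fin N → A → 𝕜) {H : UserT C r}
    {a : A}
    (ha : K.Missing H a) :
    K.load q z (K.slot H a) = combo (q H) z a + K.others q z H a := by
  have hsingle : combo (q H) z a
      = ∑ G, ∑ b, if G = H ∧ b = a then combo (q G) z b else 0 := by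
    rw [Finset.sum_eq_single H, Finset.sum_eq_single a] <;> simp +contextual
  rw [hsingle, load, others, ← Finset.sum_add_distrib]
  refine Finset.sum_congr rfl fun G _ => ?_
  rw [← Finset.sum_add_distrib]
  refine Finset.sum_congr rfl fun b _ => ?_
  by_cases h : G = H ∧ b = a
  · obtain ⟨rfl, rfl⟩ := h
    simp [ha]
  · by_cases h' : K.Missing G b ∧ K.slot G b = K.slot H a
    · obtain ⟨c, hc, hcb⟩ := K.slot_collision H a G b ha h'.1 h'.2 (by tauto)
      have : ¬ K.Missing H b := fun hm => hm c hc hcb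
      simp [h, h', this]
    · rw [if_neg h', if_neg h, if_neg (by tauto), add_zero]

theorem combo_query (p : Seed C r N 𝕜 A S L) (d : UserT C r → Fin N) (z : Fin N → A → 𝕜)
    (H : UserT C r) (a : A) :
    combo (query p d H) z a = combo (p.blind H) z a + z (d H) a := by
  simp [combo, query, add_mul, Finset.sum_add_distrib, Pi.single_apply]

theorem key_add_file [Fintype A] (p : Seed C r N 𝕜 A S L) (d : UserT C r → Fin N)
    (w : Fin N → L → 𝕜) (H : UserT C r) :
    K.key o p w H + w (d H)
      = K.rebuild (K.missPart H fun a => K.signal o p d w (K.slot H a)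
          - K.others (query p d) (K.diff o p.noise w) H a)
        + K.accessible H (K.diff o p.noise w) (d H) := by
  have h : (K.missPart H fun a => K.signal o p d w (K.slot H a)
        - K.others (query p d) (K.diff o p.noise w) H a)
      = (K.missPart H fun a => p.pad (K.slot H a) + combo (p.blind H) (K.diff o p.noise w) a)
        + K.missPart H (K.diff o p.noise w (d H)) := by
    funext a
    simp only [missPart, Pi.add_apply]
    split_ifs with ha
    · rw [signal, Pi.add_apply, load_slot _ _ ha, combo_query]
      ring
    · simp
  rw [h, accessible, map_add, map_sub, rebuild_diff, key]
  abel

theorem Agree.others_eq [Fintype A] {H : UserT C r} {z z' : Fin N → A → 𝕜} (h : K.Agree H z z')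
    (q : UserT C r → Fin N → 𝕜) : K.others q z H = K.others q z' H := by
  funext a
  refine Finset.sum_congr rfl fun G _ => Finset.sum_congr rfl fun b _ => ?_
  split_ifs with hb
  · exact Finset.sum_congr rfl fun n _ => by rw [h b hb.2.2]
  · rfl

theorem Agree.accessible_eq {H : UserT C r} {z z' : Fin N → A → 𝕜} (h : K.Agree H z z')
    (n : Fin N) : K.accessible H z n = K.accessible H z' n := by
  unfold accessible
  congr 1
  funext a
  simp only [missPart, Pi.sub_apply]
  split_ifs with ha
  · simp
  · rw [h a ha]

theorem Agree.of_cache {H : UserT C r} {p p' : Seed C r N 𝕜 A S L} {w w' : Fin N → L → 𝕜}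
    (h : ∀ c ∈ H.1, K.cache o c p w = K.cache o c p' w') :
    K.Agree H (K.diff o p.noise w) (K.diff o p'.noise w') := by
  intro a ha n
  simp only [Missing, not_forall, not_not] at ha
  obtain ⟨c, hc, hca⟩ := ha
  by_cases hn : n = o
  · simp [hn, diff]
  · exact congrFun (congrFun (Prod.ext_iff.1 (h c hc)).1 ⟨n, hn⟩) ⟨a, hca⟩

theorem sum_piece (p : Seed C r N 𝕜 A S L) (w : Fin N → L → 𝕜) (G : UserT C r) :
    ∑ c ∈ G.1, K.piece o p w G c = K.key o p w G := by
  simp [piece, Finset.sum_add_distrib, K.lead_mem]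

/-- The view of a user determines its file. -/
theorem file_eq_of_view [Fintype A] {H : UserT C r} {p p' : Seed C r N 𝕜 A S L}
    {d d' : UserT C r → Fin N} {w w' : Fin N → L → 𝕜} (hs : K.signal o p d w = K.signal o p' d' w')
    (hq : query p d = query p' d') (hd : d H = d' H)
    (hc : ∀ c ∈ H.1, K.cache o c p w = K.cache o c p' w') : w (d H) = w' (d' H) := by
  have hz := Agree.of_cache o hc
  have hkey : K.key o p w H = K.key o p' w' H := by
    rw [← sum_piece, ← sum_piece]
    exact Finset.sum_congr rfl fun c h => congrFun (Prod.ext_iff.1 (hc c h)).2 ⟨H, h⟩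
  have h1 := key_add_file (K := K) o p d w H
  have h2 := key_add_file (K := K) o p' d' w' H
  rw [hs, hq, hz.others_eq, hz.accessible_eq, hd, ← h2, hkey] at h1
  rw [hd]
  exact add_left_cancel h1

/-- A cache of `G` that `H` cannot read, whenever there is one. -/
def away (K : DeliveryCode C r 𝕜 A S L) (H G : UserT C r) : Fin C :=
  if h : ∃ c ∈ G.1, c ∉ H.1 then h.choose else K.lead G

theorem away_mem (H G : UserT C r) : K.away H G ∈ G.1 := by
  unfold away
  split_ifs with h
  · exact h.choose_spec.1
  · exact K.lead_mem G

theorem away_not_mem {H G : UserT C r} (h : G ≠ H) : K.away H G ∉ H.1 := by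
  have hex : ∃ c ∈ G.1, c ∉ H.1 := by
    by_contra! hsub
    exact h (Subtype.ext (Finset.eq_of_subset_of_card_le hsub (by rw [G.2, H.2])))
  rw [away, dif_pos hex]
  exact hex.choose_spec.2

variable [Fintype A]

/-- The seed which, for the files `w'` and demands `d'`, produces the view that `H` has for `p`,
`w` and `d`, apart from the splitting of keys. -/
def retargetCore (K : DeliveryCode C r 𝕜 A S L) (o : Fin N) (H : UserT C r)
    (w w' : Fin N → L → 𝕜) (d d' : UserT C r → Fin N) (p : Seed C r N 𝕜 A S L) :
    Seed C r N 𝕜 A S L where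
  blind G := query p d G - Pi.single (d' G) 1
  noise n := p.noise n + (K.fill H (w' n) - K.fill K.base (w' n))
    - (K.fill H (w n) - K.fill K.base (w n))
  pad := K.signal o p d w - K.load (query p d) (K.diff o (fun n => p.noise n
    + (K.fill H (w' n) - K.fill K.base (w' n)) - (K.fill H (w n) - K.fill K.base (w n))) w')
  split := p.split

def retarget (K : DeliveryCode C r 𝕜 A S L) (o : Fin N) (H : UserT C r)
    (w w' : Fin N → L → 𝕜) (d d' : UserT C r → Fin N) (p : Seed C r N 𝕜 A S L) :
    Seed C r N 𝕜 A S L where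
  blind := (K.retargetCore o H w w' d d' p).blind
  noise := (K.retargetCore o H w w' d d' p).noise
  pad := (K.retargetCore o H w w' d d' p).pad
  split G c := p.split G c + if c = K.away H G
    then K.key o (K.retargetCore o H w w' d d' p) w' G - K.key o p w G else 0

variable (H : UserT C r) (w w' : Fin N → L → 𝕜) (d d' : UserT C r → Fin N)
  (p : Seed C r N 𝕜 A S L)

theorem query_retarget : query (K.retarget o H w w' d d' p) d' = query p d := by
  funext G
  simp [query, retarget, retargetCore]

theorem signal_retarget :
    K.signal o (K.retarget o H w w' d d' p) d' w' = K.signal o p d w := by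
  rw [signal, query_retarget]
  simp [retarget, retargetCore]

theorem key_retarget (G : UserT C r) : K.key o (K.retarget o H w w' d d' p) w' G
    = K.key o (K.retargetCore o H w w' d d' p) w' G := rfl

theorem split_retarget (G : UserT C r) (c : Fin C) :
    (K.retarget o H w w' d d' p).split G c = p.split G c + if c = K.away H G
      then K.key o (K.retarget o H w w' d d' p) w' G - K.key o p w G else 0 := rfl

theorem share_retarget (n : Fin N) : K.share (K.retarget o H w w' d d' p).noise w' n
    = K.share p.noise w n + K.fill H (w' n) - K.fill H (w n) := by
  simp only [share, retarget, retargetCore, map_sub, map_add, K.rebuild_fill, sub_self, sub_zero,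
    add_zero]
  abel

theorem agree_retarget : K.Agree H (K.diff o p.noise w)
    (K.diff o (K.retarget o H w w' d d' p).noise w') := by
  intro a ha n
  simp [diff, share_retarget, fill_of_not_missing ha]

theorem key_retarget_self
    (h : w' (d' H) - K.accessible H (K.diff o p.noise w) (d' H)
      = w (d H) - K.accessible H (K.diff o p.noise w) (d H)) :
    K.key o (K.retarget o H w w' d d' p) w' H = K.key o p w H := by
  have h1 := key_add_file (K := K) o p d w H
  have h2 := key_add_file (K := K) o (K.retarget o H w w' d d' p) d' w' H
  rw [signal_retarget, query_retarget, ← (agree_retarget o H w w' d d' p).others_eq,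
    ← (agree_retarget o H w w' d d' p).accessible_eq] at h2
  linear_combination (exp := 1) h2 - h1 - h

theorem cache_retarget
    (h : w' (d' H) - K.accessible H (K.diff o p.noise w) (d' H)
      = w (d H) - K.accessible H (K.diff o p.noise w) (d H)) (c : Fin C) (hc : c ∈ H.1) :
    K.cache o c (K.retarget o H w w' d d' p) w' = K.cache o c p w := by
  refine Prod.ext ?_ ?_
  · funext n a
    exact (agree_retarget o H w w' d d' p a (fun hm => hm c hc a.2) n).symm
  · funext ⟨G, hG⟩
    have hkey := key_retarget_self o H w w' d d' p h
    simp only [cache, piece]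
    by_cases hGH : G = H
    · subst hGH
      rw [hkey]
      rw [key_retarget] at hkey
      simp [retarget, hkey]
    · have hne : c ≠ K.away H G := fun e => away_not_mem hGH (e ▸ hc)
      rw [key_retarget]
      simp only [retarget, Finset.sum_add_distrib, Finset.sum_ite_eq', away_mem, if_true, hne,
        if_false, add_zero]
      congr 1
      split_ifs
      · abel
      · rfl

theorem retarget_retarget :
    K.retarget o H w' w d' d (K.retarget o H w w' d d' p) = p := by
  have hnoise : (K.retarget o H w' w d' d (K.retarget o H w w' d d' p)).noise = p.noise := by
    funext n
    simp only [retarget, retargetCore]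
    abel
  have hblind : (K.retarget o H w' w d' d (K.retarget o H w w' d d' p)).blind = p.blind := by
    funext G
    have := congrFun (query_retarget (K := K) o H w w' d d' p) G
    simp only [retarget, retargetCore] at this ⊢
    rw [this]
    simp [query]
  have hpad : (K.retarget o H w' w d' d (K.retarget o H w w' d d' p)).pad = p.pad := by
    have h := (signal_retarget (K := K) o H w' w d' d (K.retarget o H w w' d d' p)).trans
      (signal_retarget o H w w' d d' p)
    rw [signal, signal, query_retarget, query_retarget, hnoise] at h
    exact add_right_cancel h
  have hkey : ∀ G, K.key o (K.retarget o H w' w d' d (K.retarget o H w w' d d' p)) w G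
      = K.key o p w G := by
    intro G
    simp only [key, hnoise, hblind, hpad]
  refine Seed.ext hblind hnoise hpad ?_
  funext G c
  rw [split_retarget, split_retarget, hkey]
  split_ifs
  · abel
  · simp

end

theorem mask_eq_iff {ι β : Type*} [DecidableEq ι] {x x' : ι} {u u' : ι → β} :
    ((fun i => if i = x then none else some (u i)) = fun i => if i = x' then none else some (u' i))
      ↔ x = x' ∧ ∀ i, i ≠ x → u i = u' i := by
  constructor
  · intro h
    have hx : x = x' := by
      by_contra hne
      have := congrFun h x
      simp [hne] at this
    subst hx
    refine ⟨rfl, fun i hi => ?_⟩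
    have := congrFun h i
    simpa [hi] using this
  · rintro ⟨rfl, h⟩
    funext i
    split_ifs with hi
    · rfl
    · rw [h i hi]

theorem probOf_const {Ω α : Type} [Fintype Ω] [DecidableEq α] (t : ℝ) (X : Ω → α) (a : α) :
    probOf (fun _ => t) X a = (Finset.univ.filter fun ω => X ω = a).card * t := by
  simp [probOf]

/-- A delivery code yields a secretive and private caching scheme. -/
theorem nonempty_scheme {C r N F : ℕ} {𝕜 A S L : Type} [Field 𝕜] [Fintype 𝕜] [Fintype A]
    [Fintype S] [Fintype L] {M R : ℝ}
    (K : DeliveryCode C r 𝕜 A S L) (o : Fin N) (b : (Fin F → Bool) ≃ (L → 𝕜))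
    {ZT : Type} [Fintype ZT]
    (ι : ∀ c, (({n : Fin N // n ≠ o} → {a : A // K.stored c a} → 𝕜) ×
      ({G : UserT C r // c ∈ G.1} → L → 𝕜)) ↪ ZT)
    (hZ : (Fintype.card ZT : ℝ) ≤ (2 : ℝ) ^ (M * (F : ℝ)))
    (hX : (Nat.card ((S → 𝕜) × (UserT C r → Fin N → 𝕜)) : ℝ) ≤ (2 : ℝ) ^ (R * (F : ℝ))) :
    Nonempty (CCScheme C r N F M R) := by
  let _ : Fintype (Seed C r N 𝕜 A S L) := Fintype.ofFinite _
  have hseed : Nonempty (Seed C r N 𝕜 A S L) := ⟨⟨0, 0, 0, 0⟩⟩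
  have hfin : Nonempty (Fin N) := ⟨o⟩
  have hview : ∀ (H : UserT C r) (p : Seed C r N 𝕜 A S L) (w w' : Fin N → Fin F → Bool)
      (d d' : UserT C r → Fin N),
      b (w' (d' H)) - K.accessible H (K.diff o p.noise fun n => b (w n)) (d' H)
        = b (w (d H)) - K.accessible H (K.diff o p.noise fun n => b (w n)) (d H) →
      ∀ c : {c : Fin C // c ∈ H.1},
        ι c.1 (K.cache o c.1 (K.retarget o H (fun n => b (w n)) (fun n => b (w' n)) d d' p)
          fun n => b (w' n)) = ι c.1 (K.cache o c.1 p fun n => b (w n)) :=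
    fun H p w w' d d' h c => congrArg _
      (cache_retarget o H (fun n => b (w n)) (fun n => b (w' n)) d d' p h c.1 c.2)
  refine ⟨{
    Ω := Seed C r N 𝕜 A S L × (Fin N → Fin F → Bool) × (UserT C r → Fin N)
    PT := Seed C r N 𝕜 A S L
    ZT := ZT
    XT := (S → 𝕜) × (UserT C r → Fin N → 𝕜)
    μ := fun _ => ((Fintype.card
      (Seed C r N 𝕜 A S L × (Fin N → Fin F → Bool) × (UserT C r → Fin N)) : ℝ))⁻¹
    P := fun ω => ω.1
    W := fun ω => ω.2.1
    D := fun ω => ω.2.2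
    ψ := fun c p w => ι c (K.cache o c p fun n => b (w n))
    φ := fun p d w => (K.signal o p d fun n => b (w n), query p d)
    μ_nonneg := fun _ => by positivity
    μ_sum_one := by
      rw [Finset.sum_const, nsmul_eq_mul, Finset.card_univ]
      exact mul_inv_cancel₀ (Nat.cast_ne_zero.2 Fintype.card_ne_zero)
    card_ZT := hZ
    card_XT := Nat.card_eq_fintype_card (α := (S → 𝕜) × (UserT C r → Fin N → 𝕜)) ▸ hX
    indep := ?_
    correctness := ?_
    secrecy := ?_
    privacy := ?_ }⟩
  · intro p w d
    rw [probOf_const, probOf_const]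
    have h1 : (Finset.univ.filter fun ω :
        Seed C r N 𝕜 A S L × (Fin N → Fin F → Bool) × (UserT C r → Fin N) =>
        (ω.1, ω.2.1, ω.2.2) = (p, w, d)) = {(p, w, d)} := by
      ext ω
      simp
    have h2 : (Finset.univ.filter fun ω :
        Seed C r N 𝕜 A S L × (Fin N → Fin F → Bool) × (UserT C r → Fin N) =>
        ω.1 = p) = {p} ×ˢ Finset.univ := by
      ext ω
      rw [Finset.mem_product]
      simp
    rw [h1, h2]
    have hN : (N : ℝ) ≠ 0 := by exact_mod_cast (Fin.pos o).ne'
    simp only [Finset.card_singleton, Finset.card_product, Finset.card_univ, Fintype.card_prod,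
      Fintype.card_fun, Fintype.card_fin, Fintype.card_bool, ← pow_mul, mul_comm F N]
    push_cast
    field_simp
  · intro H
    refine condH_eq_zero_of_determined _ _ _ fun ω ω' h => ?_
    simp only [Prod.mk.injEq] at h
    obtain ⟨⟨hs, hq⟩, hd, hc⟩ := h
    refine b.injective (file_eq_of_view o hs hq hd fun c hc' => ?_)
    exact (ι c).injective (congrFun hc ⟨c, hc'⟩)
  · intro H
    refine mutInf_eq_zero_of_exchange _ _ ?_
    rintro ⟨p₀, w₀, d₀⟩ ⟨p₁, w₁, d₁⟩
    let z : Seed C r N 𝕜 A S L → (Fin N → Fin F → Bool) → Fin N → A → 𝕜 :=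
      fun p w => K.diff o p.noise fun n => b (w n)
    let d' : (UserT C r → Fin N) → UserT C r → Fin N := fun d => Function.update d H (d₁ H)
    let w' : Seed C r N 𝕜 A S L → (Fin N → Fin F → Bool) → (UserT C r → Fin N) →
        Fin N → Fin F → Bool :=
      fun p w d => Function.update w₁ (d₁ H) (b.symm (b (w (d H))
        - K.accessible H (z p w) (d H) + K.accessible H (z p w) (d₁ H)))
    let f : Seed C r N 𝕜 A S L × (Fin N → Fin F → Bool) × (UserT C r → Fin N) →
        Seed C r N 𝕜 A S L × (Fin N → Fin F → Bool) × (UserT C r → Fin N) :=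
      fun ω => (K.retarget o H (fun n => b (ω.2.1 n)) (fun n => b (w' ω.1 ω.2.1 ω.2.2 n)) ω.2.2
        (d' ω.2.2) ω.1, w' ω.1 ω.2.1 ω.2.2, d' ω.2.2)
    refine ⟨f, ?_, ?_⟩
    · rintro ⟨p, w, d⟩ hω ⟨p₂, w₂, d₂⟩ hω₂ hf
      rw [Set.mem_ofPred_eq, mask_eq_iff] at hω hω₂
      simp only [f, Prod.mk.injEq] at hf
      obtain ⟨hp, hw, hd⟩ := hf
      dsimp only at hω hω₂
      have hdd : d = d₂ := by
        funext G
        by_cases hG : G = H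
        · rw [hG, hω.1, hω₂.1]
        · have := congrFun hd G
          simpa [d', hG] using this
      subst hdd
      have hacc : ∀ n, K.accessible H (z p w) n = K.accessible H (z p₂ w₂) n := by
        intro n
        have e1 := (agree_retarget (K := K) o H (fun n => b (w n)) (fun n => b (w' p w d n)) d (d' d)
          p).accessible_eq n
        have e2 := (agree_retarget (K := K) o H (fun n => b (w₂ n)) (fun n => b (w' p₂ w₂ d n)) d (d' d)
          p₂).accessible_eq n
        rw [hp, hw] at e1
        exact e1.trans e2.symm
      have hww : w = w₂ := by
        funext i
        by_cases hi : i = d H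
        · have := congrFun hw (d₁ H)
          simp only [w', Function.update_self, hacc] at this
          rw [hi]
          exact b.injective (sub_left_injective (add_left_injective _ (b.symm.injective this)))
        · rw [hω.2 i hi, hω₂.2 i hi]
      subst hww
      have := retarget_retarget (K := K) o H (fun n => b (w n)) (fun n => b (w' p w d n)) d (d' d) p
      rw [hp, hw, retarget_retarget] at this
      rw [this]
    · rintro ⟨p, w, d⟩ hω
      have hcond : b (w' p w d (d' d H)) - K.accessible H (z p w) (d' d H)
          = b (w (d H)) - K.accessible H (z p w) (d H) := by
        simp [w', d']
      refine ⟨?_, Prod.ext (Prod.ext ?_ ?_) ?_⟩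
      · refine mask_eq_iff.2 ⟨by simp [f, d'], fun i hi => ?_⟩
        simp only [f, d', Function.update_self] at hi
        simp [f, w', hi]
      · exact signal_retarget o H _ _ d (d' d) p
      · exact query_retarget o H _ _ d (d' d) p
      · funext c
        exact hview H p w _ d (d' d) hcond c
  · intro H
    refine mutInf_eq_zero_of_exchange _ _ ?_
    rintro ⟨p₀, w₀, d₀⟩ ⟨p₁, w₁, d₁⟩
    let d' : (UserT C r → Fin N) → UserT C r → Fin N := fun d => Function.update d₁ H (d H)
    let f : Seed C r N 𝕜 A S L × (Fin N → Fin F → Bool) × (UserT C r → Fin N) →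
        Seed C r N 𝕜 A S L × (Fin N → Fin F → Bool) × (UserT C r → Fin N) :=
      fun ω => (K.retarget o H (fun n => b (ω.2.1 n)) (fun n => b (ω.2.1 n)) ω.2.2
        (d' ω.2.2) ω.1, ω.2.1, d' ω.2.2)
    refine ⟨f, ?_, ?_⟩
    · rintro ⟨p, w, d⟩ hω ⟨p₂, w₂, d₂⟩ hω₂ hf
      rw [Set.mem_ofPred_eq, mask_eq_iff] at hω hω₂
      simp only [f, Prod.mk.injEq] at hf
      obtain ⟨hp, hw, hd⟩ := hf
      dsimp only at hω hω₂ hw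
      subst hw
      have hdd : d = d₂ := by
        funext G
        by_cases hG : G = H
        · have := congrFun hd H
          simpa [d', hG] using this
        · rw [hω.2 G hG, hω₂.2 G hG]
      subst hdd
      have := retarget_retarget (K := K) o H (fun n => b (w n)) (fun n => b (w n)) d (d' d) p
      rw [hp, retarget_retarget] at this
      rw [this]
    · rintro ⟨p, w, d⟩ hω
      have hcond : b (w (d' d H)) - K.accessible H (K.diff o p.noise fun n => b (w n)) (d' d H)
          = b (w (d H)) - K.accessible H (K.diff o p.noise fun n => b (w n)) (d H) := by
        simp [d']
      refine ⟨?_, Prod.ext (Prod.ext ?_ ?_) (Prod.ext ?_ ?_)⟩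
      · refine mask_eq_iff.2 ⟨rfl, fun G hG => ?_⟩
        simp [f, d', hG]
      · exact signal_retarget o H _ _ d (d' d) p
      · exact query_retarget o H _ _ d (d' d) p
      · simp [f, d']
      · funext c
        exact hview H p w _ d (d' d) hcond c

end DeliveryCode


theorem exists_vandermonde_preimage {C r : ℕ} {𝕜 : Type} [Field 𝕜] (x : Fin C ↪ 𝕜)
    (G : UserT C r) (m : Fin (C - r) → 𝕜) :
    ∃ y : Fin C → 𝕜, (∀ c ∈ G.1, y c = 0) ∧ ∀ k : Fin (C - r), ∑ c, x c ^ (k : ℕ) * y c = m k := by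
  have hcard : (G.1ᶜ).card = C - r := by rw [Finset.card_compl, Fintype.card_fin, G.2]
  let e := Finset.equivFinOfCardEq hcard
  have hdet : IsUnit (Matrix.vandermonde fun i => x (e.symm i)) := by
    rw [Matrix.isUnit_iff_isUnit_det, isUnit_iff_ne_zero, Matrix.det_vandermonde_ne_zero_iff]
    exact fun i j h => e.symm.injective (Subtype.ext (x.injective h))
  obtain ⟨v, hv⟩ := Matrix.vecMul_surjective_iff_isUnit.2 hdet m
  refine ⟨fun c => if h : c ∈ G.1ᶜ then v (e ⟨c, h⟩) else 0, fun c hc => ?_, fun k => ?_⟩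
  · simp [hc]
  · rw [← hv]
    simp only [Matrix.vecMul, dotProduct, Matrix.vandermonde_apply]
    rw [← Finset.sum_subset (Finset.subset_univ G.1ᶜ) fun c _ hc => by simp [hc],
      ← Finset.sum_coe_sort, ← e.symm.sum_comp]
    refine Finset.sum_congr rfl fun i _ => ?_
    simp only [Finset.coe_mem, dite_true, Subtype.coe_eta, Equiv.apply_symm_apply]
    exact mul_comm _ _

theorem exists_mem_not_mem {C r : ℕ} {G H : UserT C r} (h : G ≠ H) : ∃ c ∈ H.1, c ∉ G.1 := by
  by_contra! hc
  exact h (Subtype.ext (Finset.eq_of_subset_of_card_le hc (G.2.trans H.2.symm).le).symm)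

noncomputable section

open Classical in
/-- Splits a file into `ℓ₁` blocks of `C - r` symbols and `ℓ₂` further symbols. Each block is
encoded by a Vandermonde code with one share per cache; each further symbol is split into one
share per user, stored by the caches which that user does not access. -/
def blockCode {C r : ℕ} {𝕜 : Type} [Field 𝕜] (x : Fin C ↪ 𝕜) (hr : 0 < r) (base : UserT C r)
    (T : UserT C (r + 1)) (ℓ₁ ℓ₂ : ℕ) :
    DeliveryCode C r 𝕜 (Fin ℓ₁ × Fin C ⊕ Fin ℓ₂ × UserT C r) (Fin ℓ₁ × UserT C (r + 1) ⊕ Fin ℓ₂)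
      (Fin ℓ₁ × Fin (C - r) ⊕ Fin ℓ₂) where
  stored c := Sum.elim (fun a => a.2 = c) fun a => c ∉ a.2.1
  slot G := Sum.elim
    (fun a => .inl (a.1, if h : a.2 ∈ G.1 then T else
      ⟨insert a.2 G.1, by rw [Finset.card_insert_of_notMem h, G.2]⟩))
    fun a => .inr a.1
  rebuild :=
    { toFun := fun y => Sum.elim (fun l => ∑ c, x c ^ (l.2 : ℕ) * y (.inl (l.1, c)))
        fun j => ∑ G, y (.inr (j, G))
      map_add' := fun y y' => by
        ext (l | j) <;> simp [mul_add, Finset.sum_add_distrib]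
      map_smul' := fun t y => by
        ext (l | j) <;> simp [Finset.mul_sum, mul_left_comm] }
  fill G m := Sum.elim
    (fun a => (exists_vandermonde_preimage x G fun k => m (.inl (a.1, k))).choose a.2)
    fun a => if a.2 = G then m (.inr a.1) else 0
  lead G := (Finset.card_pos.1 (hr.trans_eq G.2.symm)).choose
  base := base
  lead_mem G := (Finset.card_pos.1 (hr.trans_eq G.2.symm)).choose_spec
  rebuild_fill G m := by
    ext (⟨i, k⟩ | j)
    · exact (exists_vandermonde_preimage x G fun k => m (.inl (i, k))).choose_spec.2 k
    · simp
  fill_stored G m c hc a ha := by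
    rcases a with ⟨i, c'⟩ | ⟨j, G'⟩
    · obtain rfl : c' = c := ha
      exact (exists_vandermonde_preimage x G fun k => m (.inl (i, k))).choose_spec.1 c' hc
    · exact if_neg fun h : G' = G => ha (h ▸ hc)
  slot_collision H a G b ha hb hs hne := by
    rcases a with ⟨i, c⟩ | ⟨j, H'⟩ <;> rcases b with ⟨i', c'⟩ | ⟨j', G'⟩
    · have hc : c ∉ H.1 := fun h => ha c h rfl
      have hc' : c' ∉ G.1 := fun h => hb c' h rfl
      simp only [Sum.elim_inl, Sum.inl.injEq, Prod.mk.injEq, hc, hc', dite_false,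
        Subtype.mk.injEq] at hs
      obtain ⟨rfl, hs⟩ := hs
      have hmem : c' ∈ insert c H.1 := hs ▸ Finset.mem_insert_self _ _
      rcases Finset.mem_insert.1 hmem with rfl | h
      · have : G.1 = H.1 := by
          rw [← Finset.erase_insert hc', hs, Finset.erase_insert hc]
        rcases hne with h | h
        · exact absurd (Subtype.ext this) h
        · exact absurd rfl h
      · exact ⟨c', h, rfl⟩
    · simp at hs
    · simp at hs
    · obtain rfl : j' = j := by simpa using hs
      have hH : H = H' := by
        by_contra h
        obtain ⟨c, hc, hc'⟩ := exists_mem_not_mem (Ne.symm h)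
        exact ha c hc hc'
      have hG : G = G' := by
        by_contra h
        obtain ⟨c, hc, hc'⟩ := exists_mem_not_mem (Ne.symm h)
        exact hb c hc hc'
      subst hH hG
      have hGH : G ≠ H := by
        rintro rfl
        simp at hne
      obtain ⟨c, hc, hc'⟩ := exists_mem_not_mem hGH
      exact ⟨c, hc, hc'⟩

end

theorem nonempty_embedding_users_mem {C r : ℕ} (c : Fin C) :
    Nonempty ({G : UserT C r // c ∈ G.1} ↪ Fin ((C - 1).choose (r - 1))) := by
  let f : {G : UserT C r // c ∈ G.1} → {S // S ∈ (Finset.univ.erase c).powersetCard (r - 1)} :=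
    fun G => ⟨G.1.1.erase c, Finset.mem_powersetCard.2
      ⟨Finset.erase_subset_erase _ (Finset.subset_univ _), by
        rw [Finset.card_erase_of_mem G.2, G.1.2]⟩⟩
  have hf : Function.Injective f := fun G G' h => by
    have h : G.1.1.erase c = G'.1.1.erase c := congrArg Subtype.val h
    refine Subtype.ext (Subtype.ext ?_)
    rw [← Finset.insert_erase G.2, h, Finset.insert_erase G'.2]
  exact ⟨(⟨f, hf⟩ : _ ↪ _).trans (Finset.equivFinOfCardEq (by simp)).toEmbedding⟩

theorem nonempty_embedding_stored {C r : ℕ} {𝕜 : Type} [Field 𝕜] (x : Fin C ↪ 𝕜) (hr : 0 < r)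
    (base : UserT C r) (T : UserT C (r + 1)) (ℓ₁ ℓ₂ : ℕ) (c : Fin C) :
    Nonempty ({a // (blockCode x hr base T ℓ₁ ℓ₂).stored c a} ↪
      Fin ℓ₁ ⊕ Fin ℓ₂ × UserT C r) := by
  refine ⟨⟨fun a => Sum.map Prod.fst id a.1, ?_⟩⟩
  rintro ⟨⟨i, c'⟩ | a, h⟩ ⟨⟨i', c''⟩ | a', h'⟩ heq
  · obtain rfl : c' = c := h
    obtain rfl : c'' = c' := h'
    obtain rfl : i = i' := by simpa using heq
    rfl
  · simp at heq
  · simp at heq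
  · simpa using heq

/-- The number of `𝕜`-symbols stored by a cache is at most the memory. -/
theorem memory_bound {C r N K U ℓ₁ ℓ₂ : ℕ} {M : ℝ} (hrC : r < C) (hN : 1 ≤ N)
    (hℓ : (N - 1) * (K * ℓ₂) ≤ ℓ₁) (hM : (N : ℝ) / ((C : ℝ) - r) + U ≤ M) :
    (((N - 1) * (ℓ₁ + ℓ₂ * K) + U * (ℓ₁ * (C - r) + ℓ₂) : ℕ) : ℝ)
      ≤ M * ((ℓ₁ * (C - r) + ℓ₂ : ℕ) : ℝ) := by
  have hpos : (0 : ℝ) < (C : ℝ) - r := sub_pos.2 (by exact_mod_cast hrC)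
  have h1 : (((N - 1) * (ℓ₁ + ℓ₂ * K) : ℕ) : ℝ) ≤ N * ℓ₁ := by
    obtain ⟨n, rfl⟩ := Nat.exists_eq_add_of_le hN
    have : (1 + n - 1) * (ℓ₁ + ℓ₂ * K) ≤ (1 + n) * ℓ₁ := by
      rw [Nat.add_sub_cancel_left] at hℓ ⊢
      nlinarith
    exact_mod_cast this
  have h2 : (N : ℝ) * ℓ₁ ≤ N / ((C : ℝ) - r) * (ℓ₁ * ((C : ℝ) - r) + ℓ₂) := by
    have : (N : ℝ) / ((C : ℝ) - r) * (ℓ₁ * ((C : ℝ) - r) + ℓ₂)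
        = N * ℓ₁ + N / ((C : ℝ) - r) * ℓ₂ := by
      field_simp
    rw [this]
    exact le_add_of_nonneg_right (by positivity)
  have h3 : (0 : ℝ) ≤ ℓ₁ * ((C : ℝ) - r) + ℓ₂ := by positivity
  have h4 := mul_le_mul_of_nonneg_right hM h3
  rw [Nat.cast_add, Nat.cast_mul U]
  push_cast [Nat.cast_sub hrC.le] at h1 ⊢
  linarith

theorem three_mul_le_two_mul_choose {C r : ℕ} (hr : 1 ≤ r) (hrC : r + 1 < C) :
    3 * (r + 1) ≤ 2 * C.choose r := by
  have h1 : (r + 2).choose r ≤ C.choose r := Nat.choose_le_choose r hrC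
  have h2 : (r + 2).choose r = (r + 2) * (r + 1) / 2 := by
    rw [Nat.choose_symm_add, Nat.choose_two_right]
    rfl
  have h3 : 2 ∣ (r + 2) * (r + 1) := by
    rw [mul_comm]
    exact (Nat.even_mul_succ_self (r + 1)).two_dvd
  have h4 : (r + 2) * (r + 1) = 2 * (r + 2).choose r := by
    rw [h2, Nat.mul_div_cancel' h3]
  nlinarith

/-- The number of transmitted `𝕜`-symbols is at most the rate. -/
theorem rate_bound {C r N ℓ₁ ℓ₂ : ℕ} (hr : 1 ≤ r) (hrC : r + 1 < C)
    (hℓ : 2 * (C.choose r * N) ≤ ℓ₂) :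
    ((ℓ₁ * C.choose (r + 1) + ℓ₂ + C.choose r * N : ℕ) : ℝ)
      ≤ (C.choose r : ℝ) / ((r : ℝ) + 1) * ((ℓ₁ * (C - r) + ℓ₂ : ℕ) : ℝ) := by
  have h1 := Nat.choose_succ_right_eq C r
  have h2 := three_mul_le_two_mul_choose hr hrC
  have : (ℓ₁ * C.choose (r + 1) + ℓ₂ + C.choose r * N) * (r + 1)
      ≤ C.choose r * (ℓ₁ * (C - r) + ℓ₂) := by
    have h3 : ℓ₁ * (C.choose (r + 1) * (r + 1)) = ℓ₁ * (C.choose r * (C - r)) := by rw [h1]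
    have h4 := Nat.mul_le_mul_right ℓ₂ h2
    have h5 := Nat.mul_le_mul_right (r + 1) hℓ
    nlinarith
  rw [div_mul_eq_mul_div, le_div_iff₀ (by positivity)]
  exact_mod_cast this

theorem pow_cast_le_rpow {k m : ℕ} {t : ℝ} {F : ℕ} (h : (m : ℝ) ≤ t * F) :
    (((2 ^ k) ^ m : ℕ) : ℝ) ≤ (2 : ℝ) ^ (t * ((k * F : ℕ) : ℝ)) := by
  rw [← pow_mul, Nat.cast_pow, Nat.cast_ofNat, ← Real.rpow_natCast]
  refine Real.rpow_le_rpow_of_exponent_le one_le_two ?_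
  push_cast
  nlinarith [mul_le_mul_of_nonneg_left h (Nat.cast_nonneg (α := ℝ) k)]

set_option synthInstance.maxSize 512 in
theorem exists_scheme {C r N : ℕ} (hr : 1 ≤ r) (hrC : r + 1 < C) (hN : 2 ≤ N) {M : ℝ}
    (hM : (N : ℝ) / ((C : ℝ) - r) + ((C - 1).choose (r - 1) : ℕ) ≤ M) :
    ∃ F, 1 ≤ F ∧ Nonempty (CCScheme C r N F M ((C.choose r : ℝ) / ((r : ℝ) + 1))) := by
  have hC : C ≠ 0 := by omega
  obtain ⟨𝕜, _, _, hq⟩ : ∃ (𝕜 : Type) (_ : Field 𝕜) (_ : Fintype 𝕜), Fintype.card 𝕜 = 2 ^ C :=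
    ⟨GaloisField 2 C, inferInstance, Fintype.ofFinite _,
      Fintype.card_eq_nat_card.trans (GaloisField.card 2 C hC)⟩
  let _ : Inhabited 𝕜 := ⟨0⟩
  obtain ⟨x⟩ : Nonempty (Fin C ↪ 𝕜) := Function.Embedding.nonempty_of_card_le (by
    rw [Fintype.card_fin, hq]
    exact Nat.lt_two_pow_self.le)
  obtain ⟨base⟩ : Nonempty (UserT C r) := Fintype.card_pos_iff.1 (by
    rw [Fintype.card_finset_len, Fintype.card_fin]
    exact Nat.choose_pos (by omega))
  obtain ⟨T⟩ : Nonempty (UserT C (r + 1)) := Fintype.card_pos_iff.1 (by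
    rw [Fintype.card_finset_len, Fintype.card_fin]
    exact Nat.choose_pos (by omega))
  let ℓ₂ := 2 * (C.choose r * N)
  let ℓ₁ := (N - 1) * (C.choose r * ℓ₂)
  have hℓ₂ : 0 < ℓ₂ := by
    have := Nat.choose_pos (show r ≤ C by omega)
    positivity
  let o : Fin N := ⟨0, by omega⟩
  have hcard : Fintype.card (Fin (C * (ℓ₁ * (C - r) + ℓ₂)) → Bool)
      = Fintype.card (Fin ℓ₁ × Fin (C - r) ⊕ Fin ℓ₂ → 𝕜) := by
    simp [hq, pow_mul]
  have hZ : Fintype.card (({n : Fin N // n ≠ o} → Fin ℓ₁ ⊕ Fin ℓ₂ × UserT C r → 𝕜) ×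
      (Fin ((C - 1).choose (r - 1)) → Fin ℓ₁ × Fin (C - r) ⊕ Fin ℓ₂ → 𝕜)) = (2 ^ C) ^
        ((N - 1) * (ℓ₁ + ℓ₂ * C.choose r) + (C - 1).choose (r - 1) * (ℓ₁ * (C - r) + ℓ₂)) := by
    rw [← hq]
    simp only [ne_eq, Fintype.card_prod, Fintype.card_fun, Fintype.card_sum, Fintype.card_fin,
      Fintype.card_finset_len, Fintype.card_subtype_compl, Fintype.card_unique]
    ring
  have hX : Nat.card ((Fin ℓ₁ × UserT C (r + 1) ⊕ Fin ℓ₂ → 𝕜) × (UserT C r → Fin N → 𝕜))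
      = (2 ^ C) ^ (ℓ₁ * C.choose (r + 1) + ℓ₂ + C.choose r * N) := by
    rw [Nat.card_eq_fintype_card, ← hq]
    simp only [Fintype.card_prod, Fintype.card_fun, Fintype.card_sum, Fintype.card_fin,
      Fintype.card_finset_len]
    ring
  refine ⟨C * (ℓ₁ * (C - r) + ℓ₂), Nat.mul_pos (by omega) (by omega),
    (blockCode x hr base T ℓ₁ ℓ₂).nonempty_scheme o (Fintype.equivOfCardEq hcard)
      (fun c => .prodMap
        (.arrowCongrRight (.arrowCongrLeft (nonempty_embedding_stored x hr base T ℓ₁ ℓ₂ c).some))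
        (.arrowCongrLeft (nonempty_embedding_users_mem c).some)) ?_ ?_⟩
  · rw [hZ]
    exact pow_cast_le_rpow (memory_bound (by omega) (by omega) le_rfl hM)
  · rw [hX]
    exact pow_cast_le_rpow (rate_bound hr hrC le_rfl)

/-- Theorem 4, order-optimality for `r < C−1`: for the
multi-access combinatorial topology with `C` caches, access degree `1 ≤ r < C−1`,
`K = C(C,r)` users and `N ≥ 2` files, if `K ≤ 5(r+1)` then for every memory size
`M ≥ N/(C−r) + C(C−1,r−1)` the proposed secretive-and-private scheme is within a
multiplicative factor `5` of optimal: some rate `R ≤ C(C,r)/(r+1)` is achievable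
at memory `M`, and `C(C,r)/(r+1) ≤ 5·R*(M)`, i.e. `C(C,r)/(r+1) ≤ 5·R'` for every
achievable rate `R'` at memory `M`; hence `R(M)/R*(M) ≤ 5`. -/
theorem stmt_9 (C r N : ℕ) (hr1 : 1 ≤ r) (hrC : r + 1 < C) (hN : 2 ≤ N)
    (hK : C.choose r ≤ 5 * (r + 1)) (M : ℝ)
    (hM : (N : ℝ) / ((C : ℝ) - (r : ℝ)) + (((C - 1).choose (r - 1) : ℕ) : ℝ) ≤ M) :
    (∃ R : ℝ, R ≤ ((C.choose r : ℕ) : ℝ) / ((r : ℝ) + 1) ∧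
        ∃ F : ℕ, 1 ≤ F ∧ Nonempty (CCScheme C r N F M R)) ∧
      (∀ R' : ℝ, (∃ F : ℕ, 1 ≤ F ∧ Nonempty (CCScheme C r N F M R')) →
        ((C.choose r : ℕ) : ℝ) / ((r : ℝ) + 1) ≤ 5 * R') := by
  refine ⟨⟨_, le_rfl, exists_scheme hr1 hrC hN hM⟩, ?_⟩
  rintro R' ⟨F, hF, ⟨s⟩⟩
  have h1 : 1 ≤ R' := s.one_le_rate hF hN (by omega)
  have h2 : ((C.choose r : ℕ) : ℝ) / ((r : ℝ) + 1) ≤ 5 := by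
    rw [div_le_iff₀ (by positivity)]
    exact_mod_cast hK
  linarith
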